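/- Let d ≥ 1, δ ≥ 0 and 1 < p⁻ ≤ p⁺ < ∞. There exists a constant c ≥ 1, depending only on d, p⁻, p⁺ and δ, such that for all exponents p, q ∈ [p⁻, p⁺] and all matrices A, B ∈ ℝ^{d×d}: c⁻¹ ((φ_p)_{|A^sym|})*(|S_p(A) − S_q(B)|) ≤ |F*_p(S_p(A)) − F*_p(S_q(B))|² ≤ c ((φ_p)_{|A^sym|})*(|S_p(A) − S_q(B)|). -/

import Mathlib

open MeasureTheory

/-- The shifted N-function `(φ_p)_a(r) = ∫₀^r (δ+a+s)^{p-2} s ds`. -/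
noncomputable def phiShift (δ p a r : ℝ) : ℝ :=
  ∫ s in (0:ℝ)..r, (δ + a + s) ^ (p - 2) * s

/-- The Fenchel conjugate `ψ*(r) = sup_{s ≥ 0} (r·s − ψ(s))`. -/
noncomputable def fconj (ψ : ℝ → ℝ) (r : ℝ) : ℝ :=
  ⨆ s : NNReal, (r * (s : ℝ) - ψ (s : ℝ))

/-- The symmetric part `A^sym := ½(A + Aᵀ)`. -/
noncomputable def msym {d : ℕ} (A : Matrix (Fin d) (Fin d) ℝ) : Matrix (Fin d) (Fin d) ℝ :=
  (2 : ℝ)⁻¹ • (A + A.transpose)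

/-- The Frobenius norm of a matrix. -/
noncomputable def frob {d : ℕ} (A : Matrix (Fin d) (Fin d) ℝ) : ℝ :=
  Real.sqrt (∑ i, ∑ j, (A i j) ^ 2)

/-- `S_p(A) := (δ+|A^sym|)^{p−2} A^sym`. -/
noncomputable def Smap {d : ℕ} (δ p : ℝ) (A : Matrix (Fin d) (Fin d) ℝ) :
    Matrix (Fin d) (Fin d) ℝ :=
  ((δ + frob (msym A)) ^ (p - 2)) • msym A

/-- `F*_p(A) := (δ^{p−1}+|A^sym|)^{(p'−2)/2} A^sym` with `p' = p/(p−1)`. -/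
noncomputable def Fstar {d : ℕ} (δ p : ℝ) (A : Matrix (Fin d) (Fin d) ℝ) :
    Matrix (Fin d) (Fin d) ℝ :=
  ((δ ^ (p - 1) + frob (msym A)) ^ ((p / (p - 1) - 2) / 2)) • msym A

open Set

/-- The profile `t ↦ (m + t)^γ t`, the integrand of the shifted N-functions. -/
noncomputable def powProfile (m γ t : ℝ) : ℝ := (m + t) ^ γ * t

theorem powProfile_nonneg {m γ t : ℝ} (hm : 0 ≤ m) (ht : 0 ≤ t) : 0 ≤ powProfile m γ t := by
  unfold powProfile; positivity

/-- Powers of comparable nonnegative numbers are comparable. -/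
theorem rpow_le_of_comparable {x y C γ Γ : ℝ} (hx : 0 ≤ x) (hy : 0 ≤ y) (hC : 1 ≤ C)
    (hxy : x ≤ C * y) (hyx : y ≤ C * x) (hγ : |γ| ≤ Γ) : x ^ γ ≤ C ^ Γ * y ^ γ := by
  have hC0 : 0 < C := by linarith
  have hΓ : 0 ≤ Γ := (abs_nonneg γ).trans hγ
  have hCΓ : 1 ≤ C ^ Γ := Real.one_le_rpow hC hΓ
  rcases hy.eq_or_lt with rfl | hy
  · have : x = 0 := by linarith
    subst this
    exact le_mul_of_one_le_left (Real.rpow_nonneg le_rfl _) hCΓ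
  have hx : 0 < x := by
    rcases hx.eq_or_lt with rfl | hx
    · linarith
    · exact hx
  rcases le_total 0 γ with h | h
  · calc x ^ γ ≤ (C * y) ^ γ := Real.rpow_le_rpow hx.le hxy h
      _ = C ^ γ * y ^ γ := Real.mul_rpow hC0.le hy.le
      _ ≤ C ^ Γ * y ^ γ := by
        gcongr
        exact (le_abs_self γ).trans hγ
  · calc x ^ γ ≤ (C⁻¹ * y) ^ γ := by
          apply Real.rpow_le_rpow_of_nonpos (by positivity) _ h
          rw [inv_mul_le_iff₀ hC0]; exact hyx
      _ = C ^ (-γ) * y ^ γ := by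
        rw [Real.mul_rpow (by positivity) hy.le, Real.inv_rpow hC0.le, Real.rpow_neg hC0.le]
      _ ≤ C ^ Γ * y ^ γ := by
        gcongr
        exact (neg_le_abs γ).trans hγ

theorem powProfile_mul_le {m γ l t β : ℝ} (hm : 0 ≤ m) (ht : 0 ≤ t) (hl : 0 ≤ l) (hl1 : l ≤ 1)
    (hβ : 0 < β) (hβ1 : β ≤ 1) (hβγ : β ≤ 1 + γ) :
    powProfile m γ (l * t) ≤ l ^ β * powProfile m γ t := by
  unfold powProfile
  rcases hl.eq_or_lt with rfl | hl
  · simp [Real.zero_rpow hβ.ne']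
  rcases ht.eq_or_lt with rfl | ht
  · simp
  have h1 : (m + l * t) ^ γ * l ≤ l ^ β * (m + t) ^ γ := by
    rcases le_total 0 γ with h | h
    · calc (m + l * t) ^ γ * l ≤ (m + t) ^ γ * l ^ β := by
            gcongr
            · nlinarith
            · calc l = l ^ (1 : ℝ) := (Real.rpow_one l).symm
                _ ≤ l ^ β := Real.rpow_le_rpow_of_exponent_ge hl hl1 hβ1
        _ = _ := mul_comm _ _
    · calc (m + l * t) ^ γ * l ≤ (l * (m + t)) ^ γ * l := by
            gcongr ?_ * l
            exact Real.rpow_le_rpow_of_nonpos (by positivity) (by nlinarith) h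
        _ = l ^ (1 + γ) * (m + t) ^ γ := by
            rw [Real.mul_rpow hl.le (by positivity), Real.rpow_add hl, Real.rpow_one]; ring
        _ ≤ l ^ β * (m + t) ^ γ := by
            gcongr ?_ * _
            exact Real.rpow_le_rpow_of_exponent_ge hl hl1 hβγ
  calc (m + l * t) ^ γ * (l * t) = (m + l * t) ^ γ * l * t := by ring
    _ ≤ l ^ β * (m + t) ^ γ * t := by gcongr
    _ = _ := by ring

theorem le_powProfile_mul {m γ l t κ : ℝ} (hm : 0 ≤ m) (ht : 0 ≤ t) (hl : 0 ≤ l) (hl1 : l ≤ 1)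
    (hκ1 : 1 ≤ κ) (hκγ : 1 + γ ≤ κ) :
    l ^ κ * powProfile m γ t ≤ powProfile m γ (l * t) := by
  unfold powProfile
  rcases hl.eq_or_lt with rfl | hl
  · simp [Real.zero_rpow (by linarith : κ ≠ 0)]
  rcases ht.eq_or_lt with rfl | ht
  · simp
  have h1 : l ^ κ * (m + t) ^ γ ≤ (m + l * t) ^ γ * l := by
    rcases le_total 0 γ with h | h
    · calc l ^ κ * (m + t) ^ γ ≤ l ^ (1 + γ) * (m + t) ^ γ := by
            gcongr ?_ * _
            exact Real.rpow_le_rpow_of_exponent_ge hl hl1 hκγ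
        _ = (l * (m + t)) ^ γ * l := by
            rw [Real.mul_rpow hl.le (by positivity), Real.rpow_add hl, Real.rpow_one]; ring
        _ ≤ (m + l * t) ^ γ * l := by
            gcongr ?_ ^ _ * l
            nlinarith
    · calc l ^ κ * (m + t) ^ γ ≤ l * (m + l * t) ^ γ := by
            gcongr ?_ * ?_
            · calc l ^ κ ≤ l ^ (1 : ℝ) := Real.rpow_le_rpow_of_exponent_ge hl hl1 hκ1
                _ = l := Real.rpow_one l
            · exact Real.rpow_le_rpow_of_nonpos (by positivity) (by nlinarith) h
        _ = _ := mul_comm _ _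
  calc l ^ κ * ((m + t) ^ γ * t) = l ^ κ * (m + t) ^ γ * t := by ring
    _ ≤ (m + l * t) ^ γ * l * t := by gcongr
    _ = _ := by ring

theorem powProfile_mono {m γ s t : ℝ} (hm : 0 ≤ m) (hγ : -1 < γ) (hs : 0 ≤ s) (hst : s ≤ t) :
    powProfile m γ s ≤ powProfile m γ t := by
  have ht : 0 ≤ t := hs.trans hst
  rcases ht.eq_or_lt with rfl | ht
  · rw [le_antisymm hst hs]
  have hβ : 0 < min 1 (1 + γ) := lt_min one_pos (by linarith)
  have hl : s / t ≤ 1 := (div_le_one ht).2 hst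
  have h := powProfile_mul_le (γ := γ) hm ht.le (div_nonneg hs ht.le) hl hβ
    (min_le_left _ _) (min_le_right _ _)
  rw [div_mul_cancel₀ _ ht.ne'] at h
  exact h.trans (mul_le_of_le_one_left (powProfile_nonneg hm ht.le)
    (Real.rpow_le_one (by positivity) hl hβ.le))

theorem powProfile_sub_ge {m γ a b β : ℝ} (hm : 0 ≤ m) (hb : 0 ≤ b) (hba : b ≤ a)
    (hβ : 0 < β) (hβ1 : β ≤ 1) (hβγ : β ≤ 1 + γ) :
    β * ((m + a) ^ γ * (a - b)) ≤ powProfile m γ a - powProfile m γ b := by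
  rcases (hb.trans hba).eq_or_lt with rfl | ha
  · rw [le_antisymm hba hb]; simp
  have hl : b / a ≤ 1 := (div_le_one ha).2 hba
  have hl0 : 0 ≤ b / a := by positivity
  have h := powProfile_mul_le (γ := γ) hm ha.le hl0 hl hβ hβ1 hβγ
  rw [div_mul_cancel₀ _ ha.ne'] at h
  have hB := rpow_one_add_le_one_add_mul_self (s := b / a - 1) (p := β) (by linarith) hβ.le hβ1
  rw [add_sub_cancel] at hB
  have h2 := mul_le_mul_of_nonneg_right hB (powProfile_nonneg (γ := γ) hm ha.le)
  have h3 : (1 + β * (b / a - 1)) * powProfile m γ a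
      = powProfile m γ a - β * ((m + a) ^ γ * (a - b)) := by
    unfold powProfile; field_simp; ring
  linarith

theorem powProfile_sub_le {m γ a b κ : ℝ} (hm : 0 ≤ m) (hb : 0 ≤ b) (hba : b ≤ a)
    (hκ1 : 1 ≤ κ) (hκγ : 1 + γ ≤ κ) :
    powProfile m γ a - powProfile m γ b ≤ κ * ((m + a) ^ γ * (a - b)) := by
  rcases (hb.trans hba).eq_or_lt with rfl | ha
  · rw [le_antisymm hba hb]; simp
  have hl : b / a ≤ 1 := (div_le_one ha).2 hba
  have hl0 : 0 ≤ b / a := by positivity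
  have h := le_powProfile_mul (γ := γ) hm ha.le hl0 hl hκ1 hκγ
  rw [div_mul_cancel₀ _ ha.ne'] at h
  have hB := one_add_mul_self_le_rpow_one_add (s := b / a - 1) (p := κ) (by linarith) hκ1
  rw [add_sub_cancel] at hB
  have h2 := mul_le_mul_of_nonneg_right hB (powProfile_nonneg (γ := γ) hm ha.le)
  have h3 : (1 + κ * (b / a - 1)) * powProfile m γ a
      = powProfile m γ a - κ * ((m + a) ^ γ * (a - b)) := by
    unfold powProfile; field_simp; ring
  linarith

theorem exists_powProfile_eq {m γ r : ℝ} (hm : 0 ≤ m) (hγ : -1 < γ) (hr : 0 ≤ r) :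
    ∃ s, 0 ≤ s ∧ powProfile m γ s = r := by
  rcases hr.eq_or_lt with rfl | hr
  · exact ⟨0, le_rfl, by simp [powProfile]⟩
  rcases hm.eq_or_lt with rfl | hm
  · refine ⟨r ^ (1 + γ)⁻¹, by positivity, ?_⟩
    have hs : 0 < r ^ (1 + γ)⁻¹ := by positivity
    unfold powProfile
    rw [zero_add, mul_comm]
    nth_rewrite 1 [← Real.rpow_one (r ^ (1 + γ)⁻¹)]
    rw [← Real.rpow_add hs, Real.rpow_inv_rpow hr.le (by linarith)]
  have hβ : 0 < min 1 (1 + γ) := lt_min one_pos (by linarith)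
  set β := min 1 (1 + γ) with hβdef
  have h1 : 0 < powProfile m γ 1 := by unfold powProfile; positivity
  set L := max 1 ((r / powProfile m γ 1) ^ β⁻¹) with hL
  have hL1 : 1 ≤ L := le_max_left _ _
  have hL0 : 0 < L := by linarith
  have hLr : r ≤ powProfile m γ L := by
    have h := powProfile_mul_le (γ := γ) hm.le hL0.le (inv_nonneg.2 hL0.le)
      (inv_le_one_of_one_le₀ hL1) hβ (min_le_left _ _) (min_le_right _ _)
    rw [inv_mul_cancel₀ hL0.ne', Real.inv_rpow hL0.le,
      le_inv_mul_iff₀ (by positivity)] at h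
    have h2 : r / powProfile m γ 1 ≤ L ^ β := by
      calc r / powProfile m γ 1 = ((r / powProfile m γ 1) ^ β⁻¹) ^ β :=
            (Real.rpow_inv_rpow (by positivity) hβ.ne').symm
        _ ≤ L ^ β := by
            gcongr
            exact le_max_right _ _
    rw [div_le_iff₀ h1] at h2
    exact h2.trans h
  have hcont : ContinuousOn (powProfile m γ) (Icc 0 L) := by
    unfold powProfile
    refine ContinuousOn.mul (ContinuousOn.rpow_const (by fun_prop) ?_) continuousOn_id
    intro x hx
    left
    have := hx.1
    linarith
  obtain ⟨s, hs, hsr⟩ := intermediate_value_Icc hL0.le hcont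
    (show r ∈ Icc (powProfile m γ 0) (powProfile m γ L) from
      ⟨by simp [powProfile, hr.le], hLr⟩)
  exact ⟨s, hs.1, hsr⟩

theorem add_powProfile_le {m p s : ℝ} (hm : 0 ≤ m) (hs : 0 ≤ s) (hp : 1 < p) :
    m ^ (p - 1) + powProfile m (p - 2) s ≤ 2 * (m + s) ^ (p - 1) := by
  have h1 : m ^ (p - 1) ≤ (m + s) ^ (p - 1) :=
    Real.rpow_le_rpow hm (by linarith) (by linarith)
  have h2 : powProfile m (p - 2) s ≤ (m + s) ^ (p - 1) := by
    rcases hs.eq_or_lt with rfl | hs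
    · simp only [powProfile, mul_zero]; positivity
    · have : (m + s) ^ (p - 1) = (m + s) ^ (p - 2) * (m + s) := by
        rw [← Real.rpow_add_one (by positivity)]; ring_nf
      rw [this]
      unfold powProfile
      gcongr
      linarith
  linarith

theorem le_add_powProfile {m p pp s : ℝ} (hm : 0 ≤ m) (hs : 0 ≤ s) (hp : 1 < p) (hpp : p ≤ pp) :
    (m + s) ^ (p - 1) ≤ 2 ^ pp * (m ^ (p - 1) + powProfile m (p - 2) s) := by
  have hK : (2 : ℝ) ^ (1 : ℝ) ≤ 2 ^ pp := Real.rpow_le_rpow_of_exponent_le (by norm_num) (by linarith)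
  rw [Real.rpow_one] at hK
  have hP : 0 ≤ powProfile m (p - 2) s := powProfile_nonneg hm hs
  have hM : 0 ≤ m ^ (p - 1) := by positivity
  rcases le_total s m with h | h
  · calc (m + s) ^ (p - 1) ≤ (2 * m) ^ (p - 1) :=
          Real.rpow_le_rpow (by positivity) (by linarith) (by linarith)
      _ = 2 ^ (p - 1) * m ^ (p - 1) := Real.mul_rpow (by norm_num) hm
      _ ≤ 2 ^ pp * (m ^ (p - 1) + powProfile m (p - 2) s) := by
          gcongr
          · norm_num
          · linarith
          · linarith
  · have h2 : (m + s) ^ (p - 1) ≤ 2 * powProfile m (p - 2) s := by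
      rcases hs.eq_or_lt with rfl | hs
      · have : m = 0 := le_antisymm h hm
        subst this
        simp [powProfile, Real.zero_rpow (by linarith : p - 1 ≠ 0)]
      · have : (m + s) ^ (p - 1) = (m + s) ^ (p - 2) * (m + s) := by
          rw [← Real.rpow_add_one (by positivity)]; ring_nf
        rw [this]
        unfold powProfile
        have h3 : 0 ≤ (m + s) ^ (p - 2) := by positivity
        nlinarith
    calc (m + s) ^ (p - 1) ≤ 2 * powProfile m (p - 2) s := h2
      _ ≤ 2 ^ pp * (m ^ (p - 1) + powProfile m (p - 2) s) := by
          gcongr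
          linarith

theorem phiShift_eq (δ p a r : ℝ) :
    phiShift δ p a r = ∫ s in (0:ℝ)..r, powProfile (δ + a) (p - 2) s := rfl

theorem intervalIntegrable_powProfile {m γ s t : ℝ} (hm : 0 ≤ m) (hγ : -1 < γ) (hs : 0 ≤ s)
    (ht : 0 ≤ t) : IntervalIntegrable (powProfile m γ) volume s t := by
  apply MonotoneOn.intervalIntegrable
  intro x hx y _ hxy
  exact powProfile_mono hm hγ ((le_min hs ht).trans hx.1) hxy

theorem integral_powProfile_le {m γ s : ℝ} (hm : 0 ≤ m) (hγ : -1 < γ) (hs : 0 ≤ s) :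
    ∫ t in (0:ℝ)..s, powProfile m γ t ≤ s * powProfile m γ s := by
  calc ∫ t in (0:ℝ)..s, powProfile m γ t ≤ ∫ _ in (0:ℝ)..s, powProfile m γ s :=
        intervalIntegral.integral_mono_on hs (intervalIntegrable_powProfile hm hγ le_rfl hs)
          intervalIntegrable_const fun x hx => powProfile_mono hm hγ hx.1 hx.2
    _ = s * powProfile m γ s := by simp

theorem le_integral_powProfile {m γ s : ℝ} (hm : 0 ≤ m) (hγ : -1 < γ) (hs : 0 ≤ s) :
    s / 2 * powProfile m γ (s / 2) ≤ ∫ t in (0:ℝ)..s, powProfile m γ t := by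
  have hs2 : 0 ≤ s / 2 := by positivity
  rw [← intervalIntegral.integral_add_adjacent_intervals
    (intervalIntegrable_powProfile hm hγ le_rfl hs2) (intervalIntegrable_powProfile hm hγ hs2 hs)]
  have h1 : 0 ≤ ∫ t in (0:ℝ)..(s / 2), powProfile m γ t :=
    intervalIntegral.integral_nonneg hs2 fun x hx => powProfile_nonneg hm hx.1
  have h2 : ∫ _ in (s / 2)..s, powProfile m γ (s / 2) ≤ ∫ t in (s / 2)..s, powProfile m γ t :=
    intervalIntegral.integral_mono_on (by linarith) intervalIntegrable_const
      (intervalIntegrable_powProfile hm hγ hs2 hs) fun x hx => powProfile_mono hm hγ hs2 hx.1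
  rw [intervalIntegral.integral_const, smul_eq_mul, sub_half] at h2
  linarith

/-- The conjugate of a shifted N-function is comparable to `r s` when `r` is the value of
its derivative at `s`. -/
theorem fconj_phiShift_bounds {δ p a s β : ℝ} (hm : 0 ≤ δ + a) (hs : 0 ≤ s)
    (hβ : 0 < β) (hβ1 : β ≤ 1) (hβp : β ≤ p - 1) :
    powProfile (δ + a) (p - 2) s * s ≤
        2 * 2 ^ β⁻¹ * fconj (phiShift δ p a) (powProfile (δ + a) (p - 2) s) ∧
      fconj (phiShift δ p a) (powProfile (δ + a) (p - 2) s) ≤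
        2 * 2 ^ β⁻¹ * (powProfile (δ + a) (p - 2) s * s) := by
  set m := δ + a with hmdef
  set γ := p - 2 with hγdef
  set r := powProfile m γ s with hrdef
  have hγ : -1 < γ := by linarith
  have hr : 0 ≤ r := powProfile_nonneg hm hs
  set K : ℝ := 2 ^ β⁻¹ with hKdef
  have hK0 : 0 < K := by positivity
  have hK1 : 1 ≤ K := Real.one_le_rpow (by norm_num) (by positivity)
  have hKβ : K⁻¹ ^ β = 1 / 2 := by
    rw [Real.inv_rpow hK0.le, hKdef, Real.rpow_inv_rpow (by norm_num) hβ.ne', one_div]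
  have hKi0 : 0 ≤ K⁻¹ := by positivity
  have hKi1 : K⁻¹ ≤ 1 := inv_le_one_of_one_le₀ hK1
  have hsmall : powProfile m γ (K⁻¹ * s) ≤ 1 / 2 * r := by
    have h := powProfile_mul_le (γ := γ) hm hs hKi0 hKi1 hβ hβ1 (by linarith)
    rwa [hKβ] at h
  have hlarge : 2 * r ≤ powProfile m γ (K * s) := by
    have h := powProfile_mul_le (γ := γ) hm (mul_nonneg hK0.le hs) hKi0 hKi1 hβ hβ1 (by linarith)
    rw [hKβ, inv_mul_cancel_left₀ hK0.ne'] at h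
    linarith
  have hub : ∀ t : NNReal, r * (t : ℝ) - phiShift δ p a t ≤ 2 * K * (r * s) := by
    intro t
    have ht : (0 : ℝ) ≤ t := t.2
    rw [phiShift_eq]
    have hlow := le_integral_powProfile hm hγ ht
    rcases le_total (t : ℝ) (2 * K * s) with h | h
    · have h1 : 0 ≤ (t : ℝ) / 2 * powProfile m γ (t / 2) :=
        mul_nonneg (by positivity) (powProfile_nonneg hm (by positivity))
      have h2 := mul_le_mul_of_nonneg_left h hr
      linarith
    · have h1 : powProfile m γ (K * s) ≤ powProfile m γ (t / 2) :=
        powProfile_mono hm hγ (by positivity) (by linarith)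
      have h2 := mul_le_mul_of_nonneg_left (hlarge.trans h1) (by positivity : (0:ℝ) ≤ t / 2)
      have h3 : 0 ≤ 2 * K * (r * s) := by positivity
      linarith
  constructor
  · have hle := le_ciSup (f := fun t : NNReal => r * (t : ℝ) - phiShift δ p a t)
      ⟨_, by rintro _ ⟨t, rfl⟩; exact hub t⟩ ⟨K⁻¹ * s, mul_nonneg hKi0 hs⟩
    have hle' : r * (K⁻¹ * s) - phiShift δ p a (K⁻¹ * s) ≤ fconj (phiShift δ p a) r := hle
    rw [phiShift_eq] at hle'
    have h1 := integral_powProfile_le (s := K⁻¹ * s) hm hγ (mul_nonneg hKi0 hs)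
    have h2 := mul_le_mul_of_nonneg_left hsmall (mul_nonneg hKi0 hs)
    have h3 : K⁻¹ * (r * s / 2) ≤ fconj (phiShift δ p a) r := by linarith
    rw [inv_mul_le_iff₀ hK0] at h3
    linarith
  · exact ciSup_le hub

section InnerProduct

variable {E : Type*} [NormedAddCommGroup E] [InnerProductSpace ℝ E]

theorem norm_rpow_smul_sub_bounds_of_le {m γ κ : ℝ} (hm : 0 ≤ m) (hγ : -(1 / 2) ≤ γ) (hκ1 : 1 ≤ κ)
    (hκγ : 1 + γ ≤ κ) {u v : E} (huv : ‖v‖ ≤ ‖u‖) :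
    ((m + ‖u‖) ^ γ) ^ 2 * ‖u - v‖ ^ 2 ≤ 36 * κ ^ 2 * 2 ^ κ *
        ‖(m + ‖u‖) ^ γ • u - (m + ‖v‖) ^ γ • v‖ ^ 2 ∧
      ‖(m + ‖u‖) ^ γ • u - (m + ‖v‖) ^ γ • v‖ ^ 2 ≤ 36 * κ ^ 2 * 2 ^ κ *
        (((m + ‖u‖) ^ γ) ^ 2 * ‖u - v‖ ^ 2) := by
  have hb := norm_nonneg v
  have ha := norm_nonneg u
  have hD0 : 0 ≤ ‖u‖ * ‖v‖ - inner ℝ u v := sub_nonneg.2 (real_inner_le_norm u v)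
  have hD1 : ‖u‖ * ‖v‖ - inner ℝ u v ≤ 2 * (‖u‖ * ‖v‖) := by
    have := (abs_le.1 (abs_real_inner_le_norm u v)).1
    linarith
  have e1 : ‖u - v‖ ^ 2 = (‖u‖ - ‖v‖) ^ 2 + 2 * (‖u‖ * ‖v‖ - inner ℝ u v) := by
    rw [norm_sub_sq_real]; ring
  have hga : 0 ≤ (m + ‖u‖) ^ γ := by positivity
  have hgb : 0 ≤ (m + ‖v‖) ^ γ := by positivity
  have e2 : ‖(m + ‖u‖) ^ γ • u - (m + ‖v‖) ^ γ • v‖ ^ 2 =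
      (powProfile m γ ‖u‖ - powProfile m γ ‖v‖) ^ 2 +
        2 * ((m + ‖u‖) ^ γ * (m + ‖v‖) ^ γ) * (‖u‖ * ‖v‖ - inner ℝ u v) := by
    rw [norm_sub_sq_real, norm_smul, norm_smul, real_inner_smul_left, real_inner_smul_right,
      Real.norm_of_nonneg hga, Real.norm_of_nonneg hgb]
    unfold powProfile; ring
  have hlo := powProfile_sub_ge (γ := γ) hm hb huv (β := 1 / 2) (by norm_num) (by norm_num)
    (by linarith)
  have hhi := powProfile_sub_le (γ := γ) hm hb huv hκ1 hκγ
  have hmono := powProfile_mono hm (by linarith : -1 < γ) hb huv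
  have hPb := powProfile_nonneg (γ := γ) hm hb
  have hcmp : ‖u‖ ≤ 2 * ‖v‖ → (m + ‖u‖) ^ γ ≤ 2 ^ κ * (m + ‖v‖) ^ γ ∧
      (m + ‖v‖) ^ γ ≤ 2 ^ κ * (m + ‖u‖) ^ γ := by
    intro h
    have hγκ : |γ| ≤ κ := abs_le.2 ⟨by linarith, by linarith⟩
    constructor <;> apply rpow_le_of_comparable _ _ _ _ _ hγκ <;> first | positivity | linarith
  have hK : (1 : ℝ) ≤ 2 ^ κ := Real.one_le_rpow (by norm_num) (by linarith)
  rw [e1, e2]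
  have hPa : powProfile m γ ‖u‖ = (m + ‖u‖) ^ γ * ‖u‖ := rfl
  have hPb' : powProfile m γ ‖v‖ = (m + ‖v‖) ^ γ * ‖v‖ := rfl
  have hprod : (m + ‖u‖) ^ γ * (m + ‖v‖) ^ γ * (‖u‖ * ‖v‖) =
      powProfile m γ ‖u‖ * powProfile m γ ‖v‖ := by unfold powProfile; ring
  generalize ‖u‖ * ‖v‖ - inner ℝ u v = D at *
  generalize powProfile m γ ‖u‖ = A at *
  generalize powProfile m γ ‖v‖ = B at *
  generalize (m + ‖u‖) ^ γ = ga at *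
  generalize (m + ‖v‖) ^ γ = gb at *
  generalize (2 : ℝ) ^ κ = K at *
  generalize ‖u‖ = a at *
  generalize ‖v‖ = b at *
  have hgx : 0 ≤ ga * (a - b) := mul_nonneg hga (by linarith)
  have hsqlo : (ga * (a - b)) ^ 2 ≤ 4 * (A - B) ^ 2 := by
    nlinarith
  have hsqhi : (A - B) ^ 2 ≤ κ ^ 2 * (ga * (a - b)) ^ 2 := by
    rw [← mul_pow]
    exact pow_le_pow_left₀ (by linarith) hhi 2
  have hκ2 : 1 ≤ κ ^ 2 := one_le_pow₀ hκ1
  have hC1 : 36 * K ≤ 36 * κ ^ 2 * K := by nlinarith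
  have hC2 : 36 * κ ^ 2 ≤ 36 * κ ^ 2 * K := le_mul_of_one_le_right (by positivity) hK
  have hgD : 0 ≤ ga * gb * D := by positivity
  have hgD2 : 0 ≤ ga ^ 2 * D := by positivity
  have hX : 0 ≤ (ga * (a - b)) ^ 2 := sq_nonneg _
  have hY : 0 ≤ (A - B) ^ 2 := sq_nonneg _
  have eL : ga ^ 2 * ((a - b) ^ 2 + 2 * D) = (ga * (a - b)) ^ 2 + 2 * (ga ^ 2 * D) := by ring
  have eR : (A - B) ^ 2 + 2 * (ga * gb) * D = (A - B) ^ 2 + 2 * (ga * gb * D) := by ring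
  rw [eL, eR]
  generalize (A - B) ^ 2 = Y at *
  have key : ga ^ 2 * D ≤ K * (ga * gb * D) + 4 * (ga * (a - b)) ^ 2 ∧
      ga * gb * D ≤ K * (ga ^ 2 * D) + 8 * (ga * (a - b)) ^ 2 := by
    rcases le_total a (2 * b) with h | h
    · obtain ⟨h1, h2⟩ := hcmp h
      have h3 := mul_le_mul_of_nonneg_left h1 (mul_nonneg hga hD0)
      have h4 := mul_le_mul_of_nonneg_left h2 (mul_nonneg hga hD0)
      constructor <;> linarith
    · have hA : a ^ 2 ≤ 4 * (a - b) ^ 2 := by nlinarith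
      have hgA := mul_le_mul_of_nonneg_left hA (sq_nonneg ga)
      constructor
      · have h1 : D ≤ a ^ 2 := by nlinarith
        have h2 := mul_le_mul_of_nonneg_left h1 (sq_nonneg ga)
        have h3 : 0 ≤ K * (ga * gb * D) := by positivity
        linarith
      · have h1 := mul_le_mul_of_nonneg_left hD1 (mul_nonneg hga hgb)
        have h2 : A * B ≤ A ^ 2 := by nlinarith
        have h3 : A ^ 2 = ga ^ 2 * a ^ 2 := by rw [hPa]; ring
        have h4 : 0 ≤ K * (ga ^ 2 * D) := by positivity
        linarith
  obtain ⟨k1, k2⟩ := key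
  generalize (ga * (a - b)) ^ 2 = X at *
  generalize ga * gb * D = V at *
  generalize ga ^ 2 * D = U at *
  have hKY : Y ≤ K * Y := le_mul_of_one_le_left hY hK
  have hKV : 0 ≤ K * V := by positivity
  have hKU : 0 ≤ K * U := by positivity
  constructor
  · have h1 := mul_le_mul_of_nonneg_right hC1 (by positivity : 0 ≤ Y + 2 * V)
    linarith
  · have h1 := mul_le_mul_of_nonneg_right hC1 hgD2
    have h2 := mul_le_mul_of_nonneg_right hC2 hX
    have h3 := mul_le_mul_of_nonneg_right hκ2 hX
    linarith

theorem norm_rpow_smul_sub_bounds {m γ κ : ℝ} (hm : 0 ≤ m) (hγ : -(1 / 2) ≤ γ) (hκ1 : 1 ≤ κ)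
    (hκγ : 1 + γ ≤ κ) (u v : E) :
    ((m + max ‖u‖ ‖v‖) ^ γ) ^ 2 * ‖u - v‖ ^ 2 ≤ 36 * κ ^ 2 * 2 ^ κ *
        ‖(m + ‖u‖) ^ γ • u - (m + ‖v‖) ^ γ • v‖ ^ 2 ∧
      ‖(m + ‖u‖) ^ γ • u - (m + ‖v‖) ^ γ • v‖ ^ 2 ≤ 36 * κ ^ 2 * 2 ^ κ *
        (((m + max ‖u‖ ‖v‖) ^ γ) ^ 2 * ‖u - v‖ ^ 2) := by
  rcases le_total ‖v‖ ‖u‖ with h | h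
  · rw [max_eq_left h]
    exact norm_rpow_smul_sub_bounds_of_le hm hγ hκ1 hκγ h
  · rw [max_eq_right h, norm_sub_rev u v, norm_sub_rev ((m + ‖u‖) ^ γ • u)]
    exact norm_rpow_smul_sub_bounds_of_le hm hγ hκ1 hκγ h

end InnerProduct

/-- The entries of a matrix as a Euclidean vector. -/
noncomputable def matVec {d : ℕ} (A : Matrix (Fin d) (Fin d) ℝ) :
    EuclideanSpace ℝ (Fin d × Fin d) :=
  WithLp.toLp 2 fun ij => A ij.1 ij.2

theorem matVec_sub {d : ℕ} (A B : Matrix (Fin d) (Fin d) ℝ) :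
    matVec (A - B) = matVec A - matVec B := rfl

theorem matVec_smul {d : ℕ} (c : ℝ) (A : Matrix (Fin d) (Fin d) ℝ) :
    matVec (c • A) = c • matVec A := rfl

theorem frob_eq_norm {d : ℕ} (A : Matrix (Fin d) (Fin d) ℝ) : frob A = ‖matVec A‖ := by
  rw [EuclideanSpace.norm_eq, Fintype.sum_prod_type]
  simp [frob, matVec]

theorem msym_Smap {d : ℕ} (δ p : ℝ) (A : Matrix (Fin d) (Fin d) ℝ) :
    msym (Smap δ p A) = Smap δ p A := by
  ext i j
  simp only [Smap, msym, Matrix.smul_apply, Matrix.add_apply, Matrix.transpose_apply, smul_eq_mul]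
  ring

theorem frob_nonneg {d : ℕ} (A : Matrix (Fin d) (Fin d) ℝ) : 0 ≤ frob A := Real.sqrt_nonneg _

theorem frob_Smap {d : ℕ} {δ p : ℝ} (hδ : 0 ≤ δ) (A : Matrix (Fin d) (Fin d) ℝ) :
    frob (Smap δ p A) = powProfile δ (p - 2) (frob (msym A)) := by
  have h := frob_nonneg (msym A)
  rw [Smap, frob_eq_norm, matVec_smul, norm_smul, ← frob_eq_norm, Real.norm_of_nonneg (by positivity)]
  rfl

/-- `|F*_p(P) - F*_p(Q)|² ≈ (δ^{p-1} + max(|P|,|Q|))^{p'-2} |P - Q|²` for symmetric `P`, `Q`. -/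
theorem frob_Fstar_sub_bounds {d : ℕ} {δ p κ : ℝ} (hδ : 0 ≤ δ) (hp : 1 < p)
    (hκ : 1 + 1 / (p - 1) ≤ κ) {P Q : Matrix (Fin d) (Fin d) ℝ} (hP : msym P = P)
    (hQ : msym Q = Q) :
    (δ ^ (p - 1) + max (frob P) (frob Q)) ^ (p / (p - 1) - 2) * frob (P - Q) ^ 2 ≤
        36 * κ ^ 2 * 2 ^ κ * frob (Fstar δ p P - Fstar δ p Q) ^ 2 ∧
      frob (Fstar δ p P - Fstar δ p Q) ^ 2 ≤ 36 * κ ^ 2 * 2 ^ κ *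
        ((δ ^ (p - 1) + max (frob P) (frob Q)) ^ (p / (p - 1) - 2) * frob (P - Q) ^ 2) := by
  have hp1 : 0 < p - 1 := by linarith
  have hpp : p / (p - 1) = 1 + 1 / (p - 1) := by field_simp; ring
  have hi : 0 < 1 / (p - 1) := by positivity
  have hmax : 0 ≤ max (frob P) (frob Q) := (frob_nonneg P).trans (le_max_left _ _)
  have hsq : (δ ^ (p - 1) + max (frob P) (frob Q)) ^ (p / (p - 1) - 2) =
      ((δ ^ (p - 1) + max (frob P) (frob Q)) ^ ((p / (p - 1) - 2) / 2)) ^ 2 := by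
    rw [← Real.rpow_mul_natCast (by positivity)]
    norm_num
  have h := norm_rpow_smul_sub_bounds (m := δ ^ (p - 1)) (γ := (p / (p - 1) - 2) / 2) (κ := κ)
    (by positivity) (by rw [hpp]; linarith) (by linarith) (by rw [hpp]; linarith)
    (matVec P) (matVec Q)
  rw [hsq]
  simpa only [Fstar, hP, hQ, frob_eq_norm, matVec_sub, matVec_smul] using h

theorem stmt9 (d : ℕ) (hd : 1 ≤ d) (δ pm pp : ℝ) (hδ : 0 ≤ δ) (hpm : 1 < pm)
    (hpmpp : pm ≤ pp) :
    ∃ c : ℝ, 1 ≤ c ∧ ∀ p q : ℝ, pm ≤ p → p ≤ pp → pm ≤ q → q ≤ pp →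
      ∀ A B : Matrix (Fin d) (Fin d) ℝ,
      c⁻¹ * fconj (phiShift δ p (frob (msym A))) (frob (Smap δ p A - Smap δ q B)) ≤
          frob (Fstar δ p (Smap δ p A) - Fstar δ p (Smap δ q B)) ^ 2 ∧
      frob (Fstar δ p (Smap δ p A) - Fstar δ p (Smap δ q B)) ^ 2 ≤
          c * fconj (phiShift δ p (frob (msym A))) (frob (Smap δ p A - Smap δ q B)) := by
  set κ := 1 + 1 / (pm - 1) with hκdef
  have hpm1 : 0 < pm - 1 := by linarith
  have hκ1 : 1 ≤ κ := by
    have : 0 < 1 / (pm - 1) := by positivity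
    linarith
  set β := min 1 (pm - 1) with hβdef
  have hβ : 0 < β := lt_min one_pos hpm1
  set K : ℝ := 2 ^ pp with hKdef
  have hK : 2 ≤ K := by
    calc (2 : ℝ) = 2 ^ (1 : ℝ) := (Real.rpow_one 2).symm
      _ ≤ 2 ^ pp := Real.rpow_le_rpow_of_exponent_le (by norm_num) (by linarith)
  set C₀ := K * (K + 2) with hC₀
  have hC₀1 : 4 ≤ C₀ := by nlinarith
  set C₁ := 36 * κ ^ 2 * 2 ^ κ with hC₁
  have hC₁1 : 1 ≤ C₁ := by
    have h1 : (1 : ℝ) ≤ 2 ^ κ := Real.one_le_rpow (by norm_num) (by linarith)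
    have h2 : 1 ≤ κ ^ 2 := one_le_pow₀ hκ1
    nlinarith
  set C₂ : ℝ := 2 * 2 ^ β⁻¹ with hC₂
  have hC₂1 : 1 ≤ C₂ := by
    have h1 : (1 : ℝ) ≤ 2 ^ β⁻¹ := Real.one_le_rpow (by norm_num) (by positivity)
    linarith
  set C₃ := C₀ ^ κ with hC₃
  have hC₃1 : 1 ≤ C₃ := Real.one_le_rpow (by linarith) (by linarith)
  have hc1 : 1 ≤ C₁ * C₃ * C₂ := one_le_mul_of_one_le_of_one_le
    (one_le_mul_of_one_le_of_one_le hC₁1 hC₃1) hC₂1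
  refine ⟨C₁ * C₃ * C₂, hc1, ?_⟩
  intro p q hp1 hp2 _ _ A B
  have hp : 1 < p := by linarith
  have hx : 0 ≤ frob (msym A) := frob_nonneg _
  have hPx : frob (Smap δ p A) = powProfile δ (p - 2) (frob (msym A)) := frob_Smap hδ A
  have hinv : 1 / (p - 1) ≤ 1 / (pm - 1) := one_div_le_one_div_of_le hpm1 (by linarith)
  obtain ⟨hF1, hF2⟩ := frob_Fstar_sub_bounds (κ := κ) hδ hp (by linarith)
    (msym_Smap δ p A) (msym_Smap δ q B)
  have hrle : frob (Smap δ p A - Smap δ q B) ≤ frob (Smap δ p A) + frob (Smap δ q B) := by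
    simp only [frob_eq_norm, matVec_sub]; exact norm_sub_le _ _
  have hQle : frob (Smap δ q B) ≤ frob (Smap δ p A) + frob (Smap δ p A - Smap δ q B) := by
    simp only [frob_eq_norm, matVec_sub]; exact norm_le_norm_add_norm_sub _ _
  have hr := frob_nonneg (Smap δ p A - Smap δ q B)
  have hP := frob_nonneg (Smap δ p A)
  generalize frob (Fstar δ p (Smap δ p A) - Fstar δ p (Smap δ q B)) ^ 2 = F at *
  generalize frob (Smap δ p A - Smap δ q B) = r at *
  generalize frob (Smap δ p A) = P at *
  generalize frob (Smap δ q B) = Q at *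
  generalize frob (msym A) = x at *
  have hm : 0 ≤ δ + x := by linarith
  obtain ⟨s, hs, hsr⟩ := exists_powProfile_eq (γ := p - 2) hm (by linarith) hr
  obtain ⟨hc_lo, hc_hi⟩ := fconj_phiShift_bounds (p := p) hm hs hβ (min_le_left _ _)
    ((min_le_right _ _).trans (by linarith))
  rw [hsr] at hc_lo hc_hi
  have a1 := add_powProfile_le hδ hx hp
  have a2 := le_add_powProfile hδ hx hp hp2
  have a3 := add_powProfile_le hm hs hp
  have a4 := le_add_powProfile hm hs hp hp2
  rw [← hPx] at a1 a2
  rw [hsr] at a3 a4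
  have hε : 0 ≤ δ ^ (p - 1) := by positivity
  have hM1 : P ≤ max P Q := le_max_left _ _
  have hM2 : Q ≤ max P Q := le_max_right _ _
  have hM3 : max P Q ≤ P + r := max_le (by linarith) hQle
  have hT : 0 ≤ (δ + x + s) ^ (p - 1) := by positivity
  have hup : δ ^ (p - 1) + max P Q ≤ C₀ * (δ + x + s) ^ (p - 1) := by
    have := mul_le_mul_of_nonneg_right hC₀1 hT
    linarith
  have hlow : (δ + x + s) ^ (p - 1) ≤ C₀ * (δ ^ (p - 1) + max P Q) := by
    have h1 : (δ + x) ^ (p - 1) ≤ K * (δ ^ (p - 1) + max P Q) :=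
      a2.trans (by gcongr)
    have h2 : (δ + x) ^ (p - 1) + r ≤ (K + 2) * (δ ^ (p - 1) + max P Q) := by linarith
    calc (δ + x + s) ^ (p - 1) ≤ K * ((δ + x) ^ (p - 1) + r) := a4
      _ ≤ K * ((K + 2) * (δ ^ (p - 1) + max P Q)) := by gcongr
      _ = _ := by rw [hC₀]; ring
  have hpq : p / (p - 1) = 1 + 1 / (p - 1) := by
    have : p - 1 ≠ 0 := by linarith
    field_simp; ring
  have hi : 0 < 1 / (p - 1) := by
    have : 0 < p - 1 := by linarith
    positivity
  have hγ : |p / (p - 1) - 2| ≤ κ := abs_le.2 ⟨by linarith, by linarith⟩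
  have hM0 : 0 ≤ δ ^ (p - 1) + max P Q := by linarith
  have b1 := rpow_le_of_comparable hM0 hT (by linarith) hup hlow hγ
  have b2 := rpow_le_of_comparable hT hM0 (by linarith) hlow hup hγ
  have hpow : ((δ + x + s) ^ (p - 1)) ^ (p / (p - 1) - 2) * r ^ 2 = r * s := by
    rw [← Real.rpow_mul (by linarith)]
    have he : (p - 1) * (p / (p - 1) - 2) = -(p - 2) := by
      have : p - 1 ≠ 0 := by linarith
      field_simp; ring
    rw [he]
    rcases hs.eq_or_lt with rfl | hs
    · have : r = 0 := by rw [← hsr]; simp [powProfile]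
      simp [this]
    · have hpos : 0 < (δ + x + s) ^ (p - 2) := by positivity
      rw [Real.rpow_neg (by linarith), ← hsr]
      unfold powProfile
      field_simp
  have d1 := mul_le_mul_of_nonneg_right b1 (sq_nonneg r)
  have d2 := mul_le_mul_of_nonneg_right b2 (sq_nonneg r)
  rw [mul_assoc, hpow] at d1
  rw [mul_assoc, hpow] at d2
  generalize (δ ^ (p - 1) + max P Q) ^ (p / (p - 1) - 2) * r ^ 2 = W at *
  generalize fconj (phiShift δ p x) r = Φ at *
  have f1 : r * s ≤ C₃ * (C₁ * F) := d2.trans (by gcongr)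
  have f2 : W ≤ C₃ * (C₂ * Φ) := d1.trans (by gcongr)
  constructor
  · rw [inv_mul_le_iff₀ (by positivity)]
    calc Φ ≤ C₂ * (r * s) := hc_hi
      _ ≤ C₂ * (C₃ * (C₁ * F)) := mul_le_mul_of_nonneg_left f1 (by linarith)
      _ = _ := by ring
  · calc F ≤ C₁ * W := hF2
      _ ≤ C₁ * (C₃ * (C₂ * Φ)) := mul_le_mul_of_nonneg_left f2 (by linarith)
      _ = _ := by ring
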